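/- arXiv:2601.17619 — 2 statements merged into one kernel-verified Lean document; each statement's English description precedes it below -/
import Mathlib

section
/- Boundary recursion for the rational functions: if G is connected with at least one edge, then Σ_{T ∈ Com(G)} 1/Π_{T∈T} ℓ_{G,T} = (1/ℓ_{G,G}) Σ_{e={v_i,v_j} ∈ E} [Σ_{T_e ∈ Com(G∖e)} 1/Π_{T∈T_e} ℓ_{G∖e,T}] evaluated at X_i ↦ X_i + Y_e, X_j ↦ X_j + Y_e (and X_i ↦ X_i + 2Y_e if e is a loop at v_i). -/
open SimpleGraph

namespace Cosmo

variable {V : Type*}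

/-- A tube of `G` is a connected subgraph. -/
def IsTube (G : SimpleGraph V) (T : G.Subgraph) : Prop := T.Connected

/-- Tubes are nested if one contains the other. -/
def Nested {G : SimpleGraph V} (S T : G.Subgraph) : Prop := S ≤ T ∨ T ≤ S

/-- Tubes overlap if their (vertex) intersection is nonempty and they are not nested. -/
def Overlapping {G : SimpleGraph V} (S T : G.Subgraph) : Prop :=
  (S.verts ∩ T.verts).Nonempty ∧ ¬ Nested S T

/-- Tubes are incompatible if there is an edge of `G` between them and they are not nested. -/
def Incompatible {G : SimpleGraph V} (S T : G.Subgraph) : Prop :=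
  (∃ u w, G.Adj u w ∧ u ∈ S.verts ∧ w ∈ T.verts) ∧ ¬ Nested S T

/-- Tubes are compatible if they are not incompatible. -/
def Compatible {G : SimpleGraph V} (S T : G.Subgraph) : Prop := ¬ Incompatible S T

/-- A complete tubing: a maximal collection of pairwise non-overlapping tubes. -/
def IsCompleteTubing (G : SimpleGraph V) (𝒯 : Set G.Subgraph) : Prop :=
  Maximal (fun 𝒞 : Set G.Subgraph =>
    (∀ T ∈ 𝒞, IsTube G T) ∧ 𝒞.Pairwise fun S T => ¬ Overlapping S T) 𝒯

/-- An admissible tubing: a maximal collection of pairwise compatible induced tubes. -/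
def IsAdmissibleTubing (G : SimpleGraph V) (𝒯 : Set G.Subgraph) : Prop :=
  Maximal (fun 𝒞 : Set G.Subgraph =>
    (∀ T ∈ 𝒞, IsTube G T ∧ T.IsInduced) ∧ 𝒞.Pairwise Compatible) 𝒯

/-- A labeling of an admissible tubing by the vertices, as in the bijection lemma:
`g v` is the tube associated to `v`, i.e. `v ∈ g v` and `v` avoids all strictly
smaller tubes of the tubing. -/
def IsVertexLabeling (G : SimpleGraph V) (𝒯 : Set G.Subgraph) (g : V → G.Subgraph) : Prop :=
  Set.BijOn g Set.univ 𝒯 ∧ ∀ v, v ∈ (g v).verts ∧ ∀ S ∈ 𝒯, S < g v → v ∉ S.verts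


open scoped Classical in
/-- The linear form `ℓ_T` attached to a tube `T` of `G`, evaluated at `(X, Y)`:
`ℓ_T = Σ_{v ∈ T} X_v + Σ_{e crossing T} Y_e + Σ_{e ∉ T between vertices of T} 2 Y_e`. -/
noncomputable def ell {V : Type*} [Fintype V] [DecidableEq V] (G : SimpleGraph V)
    (T : G.Subgraph) (X : V → ℝ) (Y : Sym2 V → ℝ) : ℝ :=
  (∑ v : V, if v ∈ T.verts then X v else 0)
  + (∑ e : Sym2 V, if e ∈ G.edgeSet ∧ ∃ u w, e = s(u, w) ∧ u ∈ T.verts ∧ w ∉ T.verts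
      then Y e else 0)
  + (∑ e : Sym2 V, if e ∈ G.edgeSet ∧ (∀ u ∈ e, u ∈ T.verts) ∧ e ∉ T.edgeSet
      then 2 * Y e else 0)

section Helpers

/-- Being a collection of pairwise non-overlapping tubes. -/
def IsTubing (G : SimpleGraph V) (𝒞 : Set G.Subgraph) : Prop :=
  (∀ T ∈ 𝒞, IsTube G T) ∧ 𝒞.Pairwise fun S T => ¬ Overlapping S T

theorem overlapping_symm {G : SimpleGraph V} {S T : G.Subgraph} (h : Overlapping S T) :
    Overlapping T S := by
  refine ⟨by rw [Set.inter_comm]; exact h.1, fun h' => h.2 h'.symm⟩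

/-- A tube not overlapping with anything in a complete tubing belongs to it. -/
theorem mem_of_complete {G : SimpleGraph V} {𝒯 : Set G.Subgraph} (h : IsCompleteTubing G 𝒯)
    {S : G.Subgraph} (hS : IsTube G S) (hno : ∀ T ∈ 𝒯, ¬ Overlapping S T) : S ∈ 𝒯 := by
  have h2 : IsTubing G (insert S 𝒯) := by
    refine ⟨?_, ?_⟩
    · rintro T (rfl | hT)
      · exact hS
      · exact h.prop.1 T hT
    · rintro A (rfl | hA) B (rfl | hB) hne
      · exact absurd rfl hne
      · exact hno B hB
      · exact fun ho => hno A hA (overlapping_symm ho)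
      · exact h.prop.2 hA hB hne
  exact h.le_of_ge h2 (Set.subset_insert S 𝒯) (Set.mem_insert S 𝒯)

theorem complete_of {G : SimpleGraph V} {𝒯 : Set G.Subgraph} (h : IsTubing G 𝒯)
    (hmax : ∀ S, IsTube G S → (∀ T ∈ 𝒯, ¬ Overlapping S T) → S ∈ 𝒯) :
    IsCompleteTubing G 𝒯 := by
  refine ⟨h, ?_⟩
  intro 𝒞 hC hle S hS
  refine hmax S (hC.1 S hS) (fun T hT => ?_)
  by_cases hST : S = T
  · subst hST
    exact fun ho => ho.2 (Or.inl le_rfl)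
  · exact hC.2 hS (hle hT) hST

theorem not_overlapping_of_complete {G : SimpleGraph V} {𝒯 : Set G.Subgraph}
    (h : IsCompleteTubing G 𝒯) {S T : G.Subgraph} (hS : S ∈ 𝒯) (hT : T ∈ 𝒯) :
    ¬ Overlapping S T := by
  by_cases hST : S = T
  · subst hST
    exact fun ho => ho.2 (Or.inl le_rfl)
  · exact h.prop.2 hS hT hST

/-- The connected component of `v`, as a subgraph. -/
def comp (G : SimpleGraph V) (v : V) : G.Subgraph := (G.connectedComponentMk v).toSubgraph

theorem comp_tube (G : SimpleGraph V) (v : V) : IsTube G (comp G v) :=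
  ConnectedComponent.connected_toSubgraph _

theorem mem_comp {G : SimpleGraph V} {v w : V} : w ∈ (comp G v).verts ↔ G.Reachable v w := by
  show w ∈ (G.connectedComponentMk v).supp ↔ _
  rw [ConnectedComponent.mem_supp_iff, ConnectedComponent.eq]
  exact ⟨fun h => h.symm, fun h => h.symm⟩

theorem comp_adj {G : SimpleGraph V} {v a b : V} (hab : G.Adj a b) (ha : G.Reachable v a) :
    (comp G v).Adj a b := by
  have hb : G.Reachable v b := ha.trans hab.reachable
  have ha' := mem_comp.2 ha
  have hb' := mem_comp.2 hb
  exact ⟨ha', hb', hab⟩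

theorem tube_reachable {G : SimpleGraph V} {T : G.Subgraph} (hT : IsTube G T) {a b : V}
    (ha : a ∈ T.verts) (hb : b ∈ T.verts) : G.Reachable a b :=
  (hT.coe.preconnected ⟨a, ha⟩ ⟨b, hb⟩).map T.hom

theorem tube_le_comp {G : SimpleGraph V} {T : G.Subgraph} (hT : IsTube G T) {v w : V}
    (hw : w ∈ T.verts) (hv : G.Reachable v w) : T ≤ comp G v := by
  refine ⟨fun x hx => mem_comp.2 (hv.trans (tube_reachable hT hw hx)), fun x y hxy => ?_⟩
  exact comp_adj hxy.adj_sub (hv.trans (tube_reachable hT hw (T.edge_vert hxy)))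

theorem comp_mem {G : SimpleGraph V} {𝒯 : Set G.Subgraph} (h : IsCompleteTubing G 𝒯) (v : V) :
    comp G v ∈ 𝒯 := by
  refine mem_of_complete h (comp_tube G v) ?_
  rintro T hT ⟨⟨w, hw1, hw2⟩, hn⟩
  exact hn (Or.inr (tube_le_comp (h.prop.1 T hT) hw2 (mem_comp.1 hw1)))

theorem comp_eq_top {G : SimpleGraph V} (hG : G.Connected) (v : V) : comp G v = ⊤ := by
  refine top_le_iff.1 ⟨fun x _ => mem_comp.2 (hG.preconnected v x), fun x y hxy => ?_⟩
  exact comp_adj (by simpa using hxy) (hG.preconnected v x)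

theorem top_mem {G : SimpleGraph V} (hG : G.Connected) {𝒯 : Set G.Subgraph}
    (h : IsCompleteTubing G 𝒯) : (⊤ : G.Subgraph) ∈ 𝒯 := by
  obtain ⟨v⟩ := hG.nonempty
  rw [← comp_eq_top hG v]
  exact comp_mem h v

/-- A subgraph of `G∖e` regarded as a subgraph of `G`. -/
def up (G : SimpleGraph V) (e : Sym2 V) (T : (G.deleteEdges {e}).Subgraph) : G.Subgraph where
  verts := T.verts
  Adj := T.Adj
  adj_sub h := (G.deleteEdges_le {e}) (T.adj_sub h)
  edge_vert h := T.edge_vert h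
  symm := T.symm

/-- A subgraph of `G` not containing `e`, regarded as a subgraph of `G∖e`. -/
def down (G : SimpleGraph V) (e : Sym2 V) (T : G.Subgraph) (he : e ∉ T.edgeSet) :
    (G.deleteEdges {e}).Subgraph where
  verts := T.verts
  Adj := T.Adj
  adj_sub {a b} h := by
    rw [deleteEdges_adj]
    refine ⟨T.adj_sub h, ?_⟩
    rintro rfl
    exact he h
  edge_vert h := T.edge_vert h
  symm := T.symm

theorem up_down (G : SimpleGraph V) (e : Sym2 V) (T : G.Subgraph) (he : e ∉ T.edgeSet) :
    up G e (down G e T he) = T := rfl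

theorem not_mem_up (G : SimpleGraph V) (e : Sym2 V) (T : (G.deleteEdges {e}).Subgraph) :
    e ∉ (up G e T).edgeSet := by
  intro h
  have h2 : e ∈ T.edgeSet := by
    induction e with
    | h a b => exact h
  have := T.edgeSet_subset h2
  simp at this

theorem up_le {G : SimpleGraph V} {e : Sym2 V} {S T : (G.deleteEdges {e}).Subgraph} :
    up G e S ≤ up G e T ↔ S ≤ T := Iff.rfl

theorem up_injective (G : SimpleGraph V) (e : Sym2 V) : Function.Injective (up G e) :=
  fun _ _ h => le_antisymm (up_le.1 h.le) (up_le.1 h.ge)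

theorem up_tube {G : SimpleGraph V} {e : Sym2 V} {T : (G.deleteEdges {e}).Subgraph} :
    IsTube G (up G e T) ↔ IsTube (G.deleteEdges {e}) T :=
  ⟨fun h => ⟨h.coe⟩, fun h => ⟨h.coe⟩⟩

theorem up_overlapping {G : SimpleGraph V} {e : Sym2 V} {S T : (G.deleteEdges {e}).Subgraph} :
    Overlapping (up G e S) (up G e T) ↔ Overlapping S T := Iff.rfl

/-- The tubing of `G` obtained from a tubing of `G∖e`. -/
def ext (G : SimpleGraph V) (e : Sym2 V) (𝒯 : Set (G.deleteEdges {e}).Subgraph) :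
    Set G.Subgraph := insert ⊤ (up G e '' 𝒯)

theorem top_not_mem_up {G : SimpleGraph V} {e : Sym2 V} (he : e ∈ G.edgeSet)
    (𝒯 : Set (G.deleteEdges {e}).Subgraph) : (⊤ : G.Subgraph) ∉ up G e '' 𝒯 := by
  rintro ⟨T, -, hT⟩
  apply not_mem_up G e T
  rw [hT, Subgraph.edgeSet_top]
  exact he

theorem ext_injective {G : SimpleGraph V} {e : Sym2 V} (he : e ∈ G.edgeSet) :
    Function.Injective (ext G e) := by
  intro A B h
  have : up G e '' A = up G e '' B := by
    have h2 := congrArg (fun s => s \ {⊤}) h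
    simpa [ext, Set.insert_sdiff_of_mem, Set.sdiff_singleton_eq_self, top_not_mem_up he] using h2
  exact (up_injective G e).image_injective this

/-- Given an edge `uv` of a connected graph `G`, every vertex is reachable from `u` or `v`
after the edge is deleted. -/
theorem reach_or {G : SimpleGraph V} (hG : G.Connected) {u v : V} (x : V) :
    (G.deleteEdges {s(u, v)}).Reachable u x ∨ (G.deleteEdges {s(u, v)}).Reachable v x := by
  obtain ⟨p⟩ := hG.preconnected x u
  induction p with
  | nil => exact Or.inl (Reachable.refl _)
  | @cons a b c hab p ih =>
    by_cases hE : s(a, b) = s(c, v)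
    · rw [Sym2.eq_iff] at hE
      rcases hE with ⟨rfl, -⟩ | ⟨rfl, -⟩
      · exact Or.inl (Reachable.refl _)
      · exact Or.inr (Reachable.refl _)
    · have : (G.deleteEdges {s(c, v)}).Adj b a := by
        rw [deleteEdges_adj]
        refine ⟨hab.symm, ?_⟩
        intro h'
        exact hE (Sym2.eq_swap.trans h')
      exact ih.imp (fun h => h.trans this.reachable) (fun h => h.trans this.reachable)

theorem ext_complete {G : SimpleGraph V} (hG : G.Connected) {e : Sym2 V} (he : e ∈ G.edgeSet)
    {𝒯 : Set (G.deleteEdges {e}).Subgraph} (h : IsCompleteTubing (G.deleteEdges {e}) 𝒯) :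
    IsCompleteTubing G (ext G e 𝒯) := by
  apply complete_of
  · refine ⟨?_, ?_⟩
    · rintro T (rfl | ⟨T, hT, rfl⟩)
      · obtain ⟨v⟩ := hG.nonempty
        rw [← comp_eq_top hG v]
        exact comp_tube G v
      · exact up_tube.2 (h.prop.1 T hT)
    · rintro A (rfl | ⟨A, hA, rfl⟩) B (rfl | ⟨B, hB, rfl⟩) hne
      · exact absurd rfl hne
      · exact fun ho => ho.2 (Or.inr le_top)
      · exact fun ho => ho.2 (Or.inl le_top)
      · exact fun ho => not_overlapping_of_complete h hA hB (up_overlapping.1 ho)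
  · intro S hS hno
    by_cases heS : e ∈ S.edgeSet
    · left
      have key : ∀ u ∈ e, up G e (comp (G.deleteEdges {e}) u) ≤ S := by
        intro u hu
        by_contra hcon
        refine hno (up G e (comp (G.deleteEdges {e}) u))
          (Or.inr ⟨_, comp_mem h u, rfl⟩) ⟨⟨u, ?_, ?_⟩, ?_⟩
        · exact Subgraph.mem_verts_of_mem_edge heS hu
        · exact mem_comp.2 (Reachable.refl _)
        · rintro (h1 | h1)
          · exact not_mem_up G e _ (Subgraph.edgeSet_mono h1 heS)
          · exact hcon h1
      induction e with
      | h u v =>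
        have hu := key u (Sym2.mem_mk_left u v)
        have hv := key v (Sym2.mem_mk_right u v)
        refine top_le_iff.1 ⟨fun x _ => ?_, fun x y hxy => ?_⟩
        · rcases reach_or hG (u := u) (v := v) x with hx | hx
          · exact hu.1 (mem_comp.2 hx)
          · exact hv.1 (mem_comp.2 hx)
        · have hxy : G.Adj x y := by simpa using hxy
          by_cases hE : s(x, y) = s(u, v)
          · have : s(x, y) ∈ S.edgeSet := hE ▸ heS
            exact this
          · have hadj : (G.deleteEdges {s(u, v)}).Adj x y := by
              rw [deleteEdges_adj]
              exact ⟨hxy, hE⟩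
            rcases reach_or hG (u := u) (v := v) x with hx | hx
            · exact hu.2 (comp_adj hadj hx)
            · exact hv.2 (comp_adj hadj hx)
    · right
      refine ⟨down G e S heS, ?_, rfl⟩
      refine mem_of_complete h (up_tube.1 hS) (fun T hT ho => ?_)
      exact hno (up G e T) (Or.inr ⟨T, hT, rfl⟩) ho

/-- In a complete tubing, some edge lies in no proper tube. -/
theorem exists_edge [Finite V] {G : SimpleGraph V} (hG : G.Connected) (hE : G.edgeSet.Nonempty)
    {𝒯 : Set G.Subgraph} (h : IsCompleteTubing G 𝒯) :
    ∃ e ∈ G.edgeSet, ∀ T ∈ 𝒯, T ≠ ⊤ → e ∉ T.edgeSet := by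
  by_contra! hcon
  obtain ⟨e, he⟩ := hE
  obtain ⟨P, hP, hPt, heP⟩ := hcon e he
  obtain ⟨M, hPM, hM⟩ := (Set.toFinite {T | T ∈ 𝒯 ∧ T ≠ ⊤}).exists_le_maximal ⟨hP, hPt⟩
  have step : ∀ x y, x ∈ M.verts → G.Adj x y → M.Adj x y := by
    intro x y hx hxy
    obtain ⟨Q, hQ, hQt, hQe⟩ := hcon s(x, y) hxy
    have hQa : Q.Adj x y := hQe
    have hn : Nested Q M := by
      by_contra hn
      exact not_overlapping_of_complete h hQ hM.prop.1 ⟨⟨x, Q.edge_vert hQa, hx⟩, hn⟩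
    have hle : Q ≤ M := hn.elim id (fun h' => hM.le_of_ge ⟨hQ, hQt⟩ h')
    exact hle.2 hQa
  have hne : ∃ x, x ∈ M.verts := by
    obtain ⟨x⟩ := (h.prop.1 M hM.prop.1).coe.nonempty
    exact ⟨x, x.2⟩
  obtain ⟨x, hx⟩ := hne
  have hall : ∀ y, y ∈ M.verts := by
    intro y
    obtain ⟨p⟩ := hG.preconnected x y
    induction p with
    | nil => exact hx
    | cons hab p ih => exact ih (M.edge_vert (step _ _ hx hab).symm)
  exact hM.prop.2 (top_le_iff.1 ⟨fun y _ => hall y,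
    fun a b hab => step a b (hall a) (by simpa using hab)⟩)

theorem exists_ext [Finite V] {G : SimpleGraph V} (hG : G.Connected) (hE : G.edgeSet.Nonempty)
    {𝒯 : Set G.Subgraph} (h : IsCompleteTubing G 𝒯) :
    ∃ e ∈ G.edgeSet, ∃ 𝒯', IsCompleteTubing (G.deleteEdges {e}) 𝒯' ∧ ext G e 𝒯' = 𝒯 := by
  obtain ⟨e, he, hnot⟩ := exists_edge hG hE h
  refine ⟨e, he, up G e ⁻¹' 𝒯, ?_, ?_⟩
  · apply complete_of
    · refine ⟨fun T hT => up_tube.1 (h.prop.1 _ hT), fun A hA B hB _ ho => ?_⟩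
      exact not_overlapping_of_complete h hA hB (up_overlapping.2 ho)
    · intro S hS hno
      refine mem_of_complete h (up_tube.2 hS) (fun T hT ho => ?_)
      by_cases hTt : T = ⊤
      · subst hTt
        exact ho.2 (Or.inl le_top)
      · exact hno (down G e T (hnot T hT hTt)) hT ho
  · ext T
    constructor
    · rintro (rfl | ⟨T, hT, rfl⟩)
      · exact top_mem hG h
      · exact hT
    · intro hT
      by_cases hTt : T = ⊤
      · exact Or.inl hTt
      · exact Or.inr ⟨down G e T (hnot T hT hTt), hT, rfl⟩

/-- The deleted edge is determined by the tubing. -/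
theorem ext_edge_unique {G : SimpleGraph V} {e f : Sym2 V} (he : e ∈ G.edgeSet)
    (hf : f ∈ G.edgeSet) {A : Set (G.deleteEdges {e}).Subgraph}
    {B : Set (G.deleteEdges {f}).Subgraph} (hA : IsCompleteTubing (G.deleteEdges {e}) A)
    (h : ext G e A = ext G f B) : e = f := by
  by_contra hne
  induction f with
  | h a b =>
    have hC : up G e (comp (G.deleteEdges {e}) a) ∈ ext G s(a, b) B := by
      rw [← h]
      exact Or.inr ⟨_, comp_mem hA a, rfl⟩
    have hab : (up G e (comp (G.deleteEdges {e}) a)).Adj a b := by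
      refine comp_adj ?_ (Reachable.refl _)
      rw [deleteEdges_adj]
      exact ⟨hf, fun h' => hne h'.symm⟩
    rcases hC with hC | ⟨T, hT, hC⟩
    · apply not_mem_up G e (comp (G.deleteEdges {e}) a)
      rw [hC, Subgraph.edgeSet_top]
      exact he
    · apply not_mem_up G s(a, b) T
      rw [hC]
      exact hab

theorem ell_up [Fintype V] [DecidableEq V] (G : SimpleGraph V) {e : Sym2 V} (he : e ∈ G.edgeSet)
    (T : (G.deleteEdges {e}).Subgraph) (X : V → ℝ) (Y : Sym2 V → ℝ) :
    ell G (up G e T) X Y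
      = ell (G.deleteEdges {e}) T (fun v => X v + if v ∈ e then Y e else 0) Y := by
  classical
  have hnot := not_mem_up G e T
  have hnotT : e ∉ T.edgeSet := by
    intro h
    apply hnot
    induction e with
    | h a b => exact h
  have hES : (up G e T).edgeSet = T.edgeSet := by
    ext f
    induction f with
    | h a b => exact Iff.rfl
  unfold ell
  rw [hES]
  have hV : (up G e T).verts = T.verts := rfl
  rw [hV]
  have h2 : (∑ f : Sym2 V, if f ∈ G.edgeSet ∧ ∃ u w, f = s(u, w) ∧ u ∈ T.verts ∧ w ∉ T.verts
      then Y f else 0) = (∑ f : Sym2 V, if f ∈ (G.deleteEdges {e}).edgeSet ∧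
        ∃ u w, f = s(u, w) ∧ u ∈ T.verts ∧ w ∉ T.verts then Y f else 0)
      + (if ∃ u w, e = s(u, w) ∧ u ∈ T.verts ∧ w ∉ T.verts then Y e else 0) := by
    rw [← Finset.sum_ite_eq' Finset.univ e (fun f =>
      if ∃ u w, f = s(u, w) ∧ u ∈ T.verts ∧ w ∉ T.verts then Y f else 0)
      |>.trans (if_pos (Finset.mem_univ e)), ← Finset.sum_add_distrib]
    refine Finset.sum_congr rfl fun f _ => ?_
    by_cases hfe : f = e
    · subst hfe; simp [he]
    · simp [edgeSet_deleteEdges, hfe]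
  have h3 : (∑ f : Sym2 V, if f ∈ G.edgeSet ∧ (∀ u ∈ f, u ∈ T.verts) ∧ f ∉ T.edgeSet
      then 2 * Y f else 0) = (∑ f : Sym2 V, if f ∈ (G.deleteEdges {e}).edgeSet ∧
        (∀ u ∈ f, u ∈ T.verts) ∧ f ∉ T.edgeSet then 2 * Y f else 0)
      + (if ∀ u ∈ e, u ∈ T.verts then 2 * Y e else 0) := by
    rw [← Finset.sum_ite_eq' Finset.univ e (fun f =>
      if ∀ u ∈ f, u ∈ T.verts then 2 * Y f else 0)
      |>.trans (if_pos (Finset.mem_univ e)), ← Finset.sum_add_distrib]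
    refine Finset.sum_congr rfl fun f _ => ?_
    by_cases hfe : f = e
    · subst hfe; simp [he, hnotT]
    · simp [edgeSet_deleteEdges, hfe]
  have h1 : (∑ v : V, if v ∈ T.verts then (X v + if v ∈ e then Y e else 0) else 0)
      = (∑ v : V, if v ∈ T.verts then X v else 0)
      + ((if ∃ u w, e = s(u, w) ∧ u ∈ T.verts ∧ w ∉ T.verts then Y e else 0)
      + (if ∀ u ∈ e, u ∈ T.verts then 2 * Y e else 0)) := by
    have h4 : (∑ v : V, if v ∈ T.verts then (if v ∈ e then Y e else 0) else 0)
      = (if ∃ u w, e = s(u, w) ∧ u ∈ T.verts ∧ w ∉ T.verts then Y e else 0)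
      + (if ∀ u ∈ e, u ∈ T.verts then 2 * Y e else 0) := by
      induction e with
      | h a b =>
        have hab : a ≠ b := G.ne_of_adj he
        have h5 : (∑ v : V, if v ∈ T.verts then (if v ∈ s(a, b) then Y s(a, b) else 0) else 0)
          = (if a ∈ T.verts then Y s(a, b) else 0) + (if b ∈ T.verts then Y s(a, b) else 0) := by
          have : ∀ v : V, (if v ∈ T.verts then (if v ∈ s(a, b) then Y s(a, b) else 0) else 0)
            = (if v = a then (if a ∈ T.verts then Y s(a, b) else 0) else 0)
            + (if v = b then (if b ∈ T.verts then Y s(a, b) else 0) else 0) := by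
            intro v
            by_cases hva : v = a
            · subst hva; simp [hab]
            · by_cases hvb : v = b
              · subst hvb; simp [hva]
              · simp [hva, hvb]
          rw [Finset.sum_congr rfl fun v _ => this v, Finset.sum_add_distrib]
          simp
        rw [h5]
        have h6 : (∃ u w, s(a, b) = s(u, w) ∧ u ∈ T.verts ∧ w ∉ T.verts) ↔
            (a ∈ T.verts ∧ b ∉ T.verts) ∨ (b ∈ T.verts ∧ a ∉ T.verts) := by
          constructor
          · rintro ⟨u, w, hs, hu, hw⟩
            rcases Sym2.eq_iff.1 hs with ⟨rfl, rfl⟩ | ⟨rfl, rfl⟩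
            · exact Or.inl ⟨hu, hw⟩
            · exact Or.inr ⟨hu, hw⟩
          · rintro (⟨hu, hw⟩ | ⟨hu, hw⟩)
            · exact ⟨a, b, rfl, hu, hw⟩
            · exact ⟨b, a, Sym2.eq_swap, hu, hw⟩
        have h7 : (∀ u ∈ s(a, b), u ∈ T.verts) ↔ a ∈ T.verts ∧ b ∈ T.verts := by
          simp
        simp only [h6, h7]
        by_cases ha : a ∈ T.verts <;> by_cases hb : b ∈ T.verts <;> simp [ha, hb, two_mul]
    rw [← h4, ← Finset.sum_add_distrib]
    refine Finset.sum_congr rfl fun v _ => ?_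
    split_ifs <;> simp
  rw [h1, h2, h3]
  ring_nf

end Helpers

open scoped Classical in
/-- boundary recursion. For `G` connected with at least one edge,
`Σ_{𝒯 ∈ Com(G)} 1/Π_{T ∈ 𝒯} ℓ_{G,T}` equals `(1/ℓ_{G,G})` times the sum over edges `e`
of the corresponding sum for `G∖e`, with `X_i ↦ X_i + Y_e` for the endpoints `v_i` of `e`. -/
theorem boundary_recursion {V : Type*} [Fintype V] [DecidableEq V] (G : SimpleGraph V)
    (hconn : G.Connected) (hedge : G.edgeSet.Nonempty)
    (X : V → ℝ) (Y : Sym2 V → ℝ) (hX : ∀ v, 0 < X v) (hY : ∀ e, 0 < Y e) :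
    ∑ᶠ 𝒯 ∈ {𝒯 : Set G.Subgraph | IsCompleteTubing G 𝒯},
        (∏ᶠ T ∈ 𝒯, ell G T X Y)⁻¹
    = (ell G ⊤ X Y)⁻¹ *
      ∑ᶠ e ∈ G.edgeSet,
        ∑ᶠ 𝒯' ∈ {𝒯' : Set (G.deleteEdges {e}).Subgraph |
            IsCompleteTubing (G.deleteEdges {e}) 𝒯'},
          (∏ᶠ T ∈ 𝒯', ell (G.deleteEdges {e}) T
              (fun v => X v + if v ∈ e then Y e else 0) Y)⁻¹ :=
  by
  have hset : {𝒯 : Set G.Subgraph | IsCompleteTubing G 𝒯}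
      = ⋃ e ∈ G.edgeSet, ext G e '' {𝒯' | IsCompleteTubing (G.deleteEdges {e}) 𝒯'} := by
    ext 𝒯
    simp only [Set.mem_ofPred_eq, Set.mem_iUnion, Set.mem_image, exists_prop]
    constructor
    · exact fun h => exists_ext hconn hedge h
    · rintro ⟨e, he, 𝒯', h, rfl⟩
      exact ext_complete hconn he h
  rw [hset, finsum_mem_biUnion _ (Set.toFinite _) (fun _ _ => Set.toFinite _), mul_finsum_mem]
  · refine finsum_mem_congr rfl fun e he => ?_
    rw [finsum_mem_image (ext_injective he).injOn, mul_finsum_mem]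
    refine finsum_mem_congr rfl fun 𝒯' _ => ?_
    rw [ext, finprod_mem_insert _ (top_not_mem_up he 𝒯') (Set.toFinite _), mul_inv,
      finprod_mem_image (up_injective G e).injOn]
    congr 2
    exact finprod_mem_congr rfl fun T _ => ell_up G he T X Y
  · intro e he f hf hne
    rw [Function.onFun, Set.disjoint_left]
    rintro _ ⟨A, hA, rfl⟩ ⟨B, hB, hBA⟩
    exact hne (ext_edge_unique he hf hA hBA.symm)

end Cosmo
end

section
/- For any finite graph G, the set of binomials G = {t_S t_T − t_{S∪T} Π_i t_{U_i}} over all pairs of overlapping tubes S, T of G (where U_1,…,U_k are the connected components of S ∩ T) is a Gröbner basis of the toric ideal I_G with respect to the reverse lexicographic order induced by any total order on the variables with t_T < t_{T'} whenever T ⊋ T'; consequently the initial ideal is init(I_G) = (t_S t_T : S, T overlapping tubes of G). -/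
open SimpleGraph

namespace Cosmo

variable {V : Type*}

/-- `𝒰` is the set of connected components of the subgraph `W`. -/
def IsComponents {V : Type*} (G : SimpleGraph V) (W : G.Subgraph) (𝒰 : Finset G.Subgraph) :
    Prop :=
  (∀ U ∈ 𝒰, U.Connected ∧ U ≤ W) ∧
  ((𝒰 : Set G.Subgraph).Pairwise fun U U' => Disjoint U.verts U'.verts) ∧
  (⋃ U ∈ 𝒰, Subgraph.verts U) = W.verts ∧
  (⋃ U ∈ 𝒰, Subgraph.edgeSet U) = W.edgeSet

/-- The type of tubes of `G`. -/
abbrev Tube {V : Type*} (G : SimpleGraph V) := {T : G.Subgraph // T.Connected}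

/-- The weight (multidegree) of a monomial exponent `u` in the variables `t_T`:
the corresponding linear combination `Σ_T u_T ℓ_T` of the linear forms
`ℓ_T = Σ_{v ∈ T} X'_v + Σ_{e ∈ T} Y'_e`, recorded as its coefficient vector. -/
noncomputable def weightVec {V : Type*} [Fintype V] [DecidableEq V] (G : SimpleGraph V)
    (u : Tube G →₀ ℕ) : (V ⊕ Sym2 V) → ℕ := by
  classical
  exact fun x => ∑ T ∈ u.support, u T *
    (Sum.elim (fun v => if v ∈ T.val.verts then 1 else 0)
      (fun e => if e ∈ T.val.edgeSet then 1 else 0) x)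

/-- The toric ideal `I_G`, generated by the binomials `t^u - t^v` with
`Σ_T u_T ℓ_T = Σ_T v_T ℓ_T`. -/
noncomputable def toricIdeal {V : Type*} [Fintype V] [DecidableEq V] (G : SimpleGraph V) :
    Ideal (MvPolynomial (Tube G) ℚ) :=
  Ideal.span {p | ∃ u v : Tube G →₀ ℕ, weightVec G u = weightVec G v ∧
    p = MvPolynomial.monomial u 1 - MvPolynomial.monomial v 1}

/-- `u` is greater than `v` in the reverse lexicographic order induced by the total
order `r` on the variables: at the `r`-smallest variable where they differ, `u` is smaller. -/
def RevLexGT {V : Type*} {G : SimpleGraph V} (r : LinearOrder (Tube G))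
    (u v : Tube G →₀ ℕ) : Prop :=
  ∃ T, u T < v T ∧ ∀ S, r.lt S T → u S = v S

/-- `m` is the leading monomial of `p` with respect to the reverse lexicographic order. -/
def IsLeadMonomial {V : Type*} {G : SimpleGraph V} (r : LinearOrder (Tube G))
    (p : MvPolynomial (Tube G) ℚ) (m : Tube G →₀ ℕ) : Prop :=
  m ∈ p.support ∧ ∀ m' ∈ p.support, m' ≠ m → RevLexGT r m m'

/-- The initial ideal of `I_G`, generated by the leading monomials of its elements. -/
noncomputable def initIdeal {V : Type*} [Fintype V] [DecidableEq V] (G : SimpleGraph V)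
    (r : LinearOrder (Tube G)) : Ideal (MvPolynomial (Tube G) ℚ) :=
  Ideal.span {q | ∃ p ∈ toricIdeal G, ∃ m, IsLeadMonomial r p m ∧
    q = MvPolynomial.monomial m (1 : ℚ)}

open scoped Classical in
/-- The set `𝒢` of binomials `t_S t_T - t_{S∪T} Π_i t_{U_i}` over overlapping tubes `S, T`,
where the `U_i` are the connected components of `S ∩ T`. -/
noncomputable def groebnerSet {V : Type*} [Fintype V] [DecidableEq V] (G : SimpleGraph V) :
    Set (MvPolynomial (Tube G) ℚ) :=
  {p | ∃ S T W : Tube G, Overlapping S.val T.val ∧ W.val = S.val ⊔ T.val ∧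
    ∃ 𝒰 : Finset (Tube G), IsComponents G (S.val ⊓ T.val) (𝒰.image Subtype.val) ∧
      p = MvPolynomial.monomial (Finsupp.single S 1 + Finsupp.single T 1) 1
        - MvPolynomial.monomial
            (Finsupp.single W 1 + ∑ U ∈ 𝒰, Finsupp.single U 1) 1}

open scoped Classical in
/-- Indicator coefficient of the linear form of a subgraph. -/
noncomputable def ind {V : Type*} {G : SimpleGraph V} (T : G.Subgraph) : (V ⊕ Sym2 V) → ℕ :=
  Sum.elim (fun v => if v ∈ T.verts then 1 else 0) (fun e => if e ∈ T.edgeSet then 1 else 0)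

theorem weightVec_eq_sum {V : Type*} [Fintype V] [DecidableEq V] (G : SimpleGraph V)
    (u : Tube G →₀ ℕ) (x : V ⊕ Sym2 V) :
    weightVec G u x = u.sum (fun T n => n * ind T.val x) := by
  unfold weightVec ind Finsupp.sum
  rfl

theorem weightVec_add {V : Type*} [Fintype V] [DecidableEq V] (G : SimpleGraph V)
    (u v : Tube G →₀ ℕ) : weightVec G (u + v) = weightVec G u + weightVec G v := by
  funext x
  simp only [Pi.add_apply, weightVec_eq_sum]
  apply Finsupp.sum_add_index'
  · simp
  · intros; ring

theorem weightVec_single {V : Type*} [Fintype V] [DecidableEq V] (G : SimpleGraph V)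
    (T : Tube G) : weightVec G (Finsupp.single T 1) = ind T.val := by
  funext x
  rw [weightVec_eq_sum, Finsupp.sum_single_index] <;> simp

theorem weightVec_finset_sum {V : Type*} [Fintype V] [DecidableEq V] (G : SimpleGraph V)
    (𝒰 : Finset (Tube G)) :
    weightVec G (∑ U ∈ 𝒰, Finsupp.single U 1) = ∑ U ∈ 𝒰, ind U.val := by
  classical
  induction 𝒰 using Finset.induction_on with
  | empty => funext x; simp [weightVec_eq_sum]
  | insert a s ha ih => rw [Finset.sum_insert ha, Finset.sum_insert ha, weightVec_add,
      weightVec_single, ih]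

theorem sum_ite_unique {α : Type*} (s : Finset α) (p : α → Prop) [DecidablePred p]
    (hu : ∀ a ∈ s, ∀ b ∈ s, p a → p b → a = b) :
    (∑ a ∈ s, if p a then 1 else 0) = if ∃ a ∈ s, p a then 1 else 0 := by
  classical
  split_ifs with h
  · obtain ⟨a, ha, hp⟩ := h
    rw [Finset.sum_eq_single a]
    · simp [hp]
    · intro b hb hne
      rw [if_neg]
      intro hpb
      exact hne (hu b hb a ha hpb hp)
    · exact fun h => absurd ha h
  · push Not at h
    apply Finset.sum_eq_zero
    intro a ha
    simp [h a ha]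

theorem ind_components {V : Type*} {G : SimpleGraph V} (W : G.Subgraph) (𝒰 : Finset (Tube G))
    [DecidableEq G.Subgraph]
    (h : IsComponents G W (𝒰.image Subtype.val)) : ∑ U ∈ 𝒰, ind U.val = ind W := by
  classical
  obtain ⟨h1, h2, h3, h4⟩ := h
  have key : ∀ A ∈ 𝒰, ∀ B ∈ 𝒰, ∀ v, v ∈ A.val.verts → v ∈ B.val.verts → A = B := by
    intro A hA B hB v hvA hvB
    by_contra hne
    have := h2 (Finset.mem_coe.2 (Finset.mem_image_of_mem _ hA))
      (Finset.mem_coe.2 (Finset.mem_image_of_mem _ hB)) (fun h => hne (Subtype.ext h))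
    exact Set.disjoint_left.1 this hvA hvB
  funext x
  rw [Finset.sum_apply]
  rcases x with v | e
  · simp only [ind, Sum.elim_inl]
    rw [sum_ite_unique 𝒰 (fun U => v ∈ U.val.verts) (fun A hA B hB => key A hA B hB v), ← h3]
    congr 1
    simp
  · simp only [ind, Sum.elim_inr]
    rw [sum_ite_unique 𝒰 (fun U => e ∈ U.val.edgeSet), ← h4]
    · congr 1
      simp
    · intro A hA B hB
      induction e with
      | _ a b =>
        intro ha hb
        exact key A hA B hB a (Subgraph.edge_vert _ ha) (Subgraph.edge_vert _ hb)

theorem ind_sup_inf {V : Type*} {G : SimpleGraph V} (S T : G.Subgraph) :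
    ind S + ind T = ind (S ⊔ T) + ind (S ⊓ T) := by
  classical
  funext x
  rcases x with v | e
  · simp only [ind, Pi.add_apply, Sum.elim_inl, Subgraph.verts_sup, Subgraph.verts_inf,
      Set.mem_union, Set.mem_inter_iff]
    by_cases h1 : v ∈ S.verts <;> by_cases h2 : v ∈ T.verts <;> simp [h1, h2]
  · simp only [ind, Pi.add_apply, Sum.elim_inr, Subgraph.edgeSet_sup, Subgraph.edgeSet_inf,
      Set.mem_union, Set.mem_inter_iff]
    by_cases h1 : e ∈ S.edgeSet <;> by_cases h2 : e ∈ T.edgeSet <;> simp [h1, h2]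

theorem connected_sup {V : Type*} {G : SimpleGraph V} {S T : G.Subgraph} (hS : S.Connected)
    (hT : T.Connected) {v : V} (h1 : v ∈ S.verts) (h2 : v ∈ T.verts) : (S ⊔ T).Connected :=
  Subgraph.connected_sup hS.preconnected hT.preconnected ⟨v, h1, h2⟩

theorem exists_components {V : Type*} [Finite V] {G : SimpleGraph V} [DecidableEq G.Subgraph]
    (W : G.Subgraph) :
    ∃ 𝒰 : Finset (Tube G), IsComponents G W (𝒰.image Subtype.val) := by
  classical
  have : Finite (Tube G) := inferInstance
  have := Fintype.ofFinite (Tube G)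
  have hex : ∀ T : G.Subgraph, T.Connected → T ≤ W →
      ∃ U, T ≤ U ∧ Maximal (fun U : G.Subgraph => U.Connected ∧ U ≤ W) U := by
    intro T h1 h2
    exact Finite.exists_le_maximal (p := fun U : G.Subgraph => U.Connected ∧ U ≤ W) ⟨h1, h2⟩
  refine ⟨Finset.univ.filter
    (fun U => Maximal (fun U : G.Subgraph => U.Connected ∧ U ≤ W) U.val), ?_, ?_, ?_, ?_⟩
  · intro U hU
    simp only [Finset.mem_image, Finset.mem_filter, Finset.mem_univ, true_and] at hU
    obtain ⟨U', h, rfl⟩ := hU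
    exact h.1
  · intro A hA B hB hne
    simp only [Finset.coe_image, Set.mem_image, Finset.mem_coe, Finset.mem_filter,
      Finset.mem_univ, true_and] at hA hB
    obtain ⟨A, hA, rfl⟩ := hA
    obtain ⟨B, hB, rfl⟩ := hB
    refine Set.disjoint_left.2 fun v h1 h2 => hne ?_
    have hc := connected_sup A.2 B.2 h1 h2
    have hle : A.val ⊔ B.val ≤ W := sup_le hA.1.2 hB.1.2
    have e1 := hA.eq_of_le ⟨hc, hle⟩ le_sup_left
    have e2 := hB.eq_of_le ⟨hc, hle⟩ le_sup_right
    exact e1.trans e2.symm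
  · ext v
    simp only [Finset.mem_image, Finset.mem_filter, Finset.mem_univ, true_and, Set.mem_iUnion,
      exists_prop]
    constructor
    · rintro ⟨U, ⟨U', h, rfl⟩, hv⟩
      exact h.1.2.1 hv
    · intro hv
      obtain ⟨U, h1, h2⟩ := hex (G.singletonSubgraph v) Subgraph.singletonSubgraph_connected
        (by simpa using hv)
      exact ⟨U, ⟨⟨U, h2.1.1⟩, h2, rfl⟩, by simpa using h1⟩
  · ext e
    induction e with
    | _ a b =>
    simp only [Finset.mem_image, Finset.mem_filter, Finset.mem_univ, true_and, Set.mem_iUnion,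
      exists_prop]
    constructor
    · rintro ⟨U, ⟨U', h, rfl⟩, hv⟩
      exact h.1.2.2 hv
    · intro hv
      have hv' : W.Adj a b := hv
      obtain ⟨U, h1, h2⟩ := hex (G.subgraphOfAdj hv'.adj_sub)
        (Subgraph.subgraphOfAdj_connected _) (subgraphOfAdj_le_of_adj _ hv')
      exact ⟨U, ⟨⟨U, h2.1.1⟩, h2, rfl⟩, h1.2 (by simp)⟩

/-- A connected subgraph covered by pairwise non-overlapping tubes lies in one of them. -/
theorem exists_ge_of_cover {V : Type*} [Finite V] {G : SimpleGraph V} (T : Tube G)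
    (C : Set (Tube G)) (hC : ∀ A ∈ C, ∀ B ∈ C, ¬ Overlapping A.val B.val)
    (hv : ∀ v ∈ T.val.verts, ∃ A ∈ C, v ∈ A.val.verts)
    (he : ∀ a b, T.val.Adj a b → ∃ A ∈ C, A.val.Adj a b) : ∃ A ∈ C, T.val ≤ A.val := by
  obtain ⟨x, hx⟩ := T.2.nonempty
  obtain ⟨A₀, hA₀, hxA₀⟩ := hv x hx
  obtain ⟨W, hW0, hW⟩ := Finite.exists_le_maximal (p := fun A : Tube G => A ∈ C) hA₀
  have hxW : x ∈ W.val.verts := hW0.1 hxA₀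
  have step : ∀ a b, a ∈ W.val.verts → T.val.Adj a b → W.val.Adj a b := by
    intro a b ha hab
    obtain ⟨R, hR, hRab⟩ := he a b hab
    have hn := hC R hR W hW.1
    have : Nested R.val W.val := by
      by_contra hne
      exact hn ⟨⟨a, hRab.fst_mem, ha⟩, hne⟩
    have hle : R ≤ W := by
      rcases this with h | h
      · exact h
      · exact hW.2 hR h
    exact hle.2 hRab
  have all : ∀ y ∈ T.val.verts, y ∈ W.val.verts := by
    intro y hy
    obtain ⟨p⟩ := T.2.coe.preconnected ⟨x, hx⟩ ⟨y, hy⟩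
    have gen : ∀ (a b : T.val.verts), T.val.coe.Walk a b → a.val ∈ W.val.verts →
        b.val ∈ W.val.verts := by
      intro a b p
      induction p with
      | nil => exact id
      | cons h _ ih => exact fun ha => ih (step _ _ ha h).snd_mem
    exact gen _ _ p hxW
  exact ⟨W, hW.1, all, fun a b hab => step a b (all a hab.fst_mem) hab⟩

theorem not_revLexGT {V : Type*} [Fintype V] [DecidableEq V]
    (G : SimpleGraph V) (r : LinearOrder (Tube G))
    (hr : ∀ T T' : Tube G, T'.val < T.val → r.lt T T') (m m' : Tube G →₀ ℕ)
    (hw : weightVec G m = weightVec G m')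
    (hm : ∀ A B : Tube G, m A ≠ 0 → m B ≠ 0 → ¬ Overlapping A.val B.val) :
    ¬ RevLexGT r m m' := by
  classical
  have := Fintype.ofFinite (Tube G)
  rintro ⟨T, hT, hlt⟩
  have cover : ∀ x, ind T.val x = 1 → ∃ S : Tube G, (r.lt T S ∧ m S ≠ 0) ∧ ind S.val x ≠ 0 := by
    intro x hx
    by_contra hcon
    push Not at hcon
    have e := congrFun hw x
    rw [weightVec_eq_sum, weightVec_eq_sum, Finsupp.sum_fintype _ _ (by simp),
      Finsupp.sum_fintype _ _ (by simp)] at e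
    refine absurd e (ne_of_lt (Finset.sum_lt_sum ?_ ⟨T, Finset.mem_univ _, ?_⟩))
    · intro S _
      rcases @lt_trichotomy _ r S T with h | h | h
      · rw [hlt S h]
      · subst h; rw [hx]; omega
      · by_cases h0 : m S = 0
        · simp [h0]
        · simp [hcon S ⟨h, h0⟩]
    · rw [hx]; omega
  obtain ⟨W, ⟨hW1, hW2⟩, hW⟩ := exists_ge_of_cover T {S | r.lt T S ∧ m S ≠ 0}
    (fun A hA B hB => hm A B hA.2 hB.2)
    (by
      intro v hv
      obtain ⟨S, hS, h⟩ := cover (Sum.inl v) (by simp [ind, hv])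
      exact ⟨S, hS, by simpa [ind] using h⟩)
    (by
      intro a b hv
      obtain ⟨S, hS, h⟩ := cover (Sum.inr s(a, b)) (by simp [ind, hv])
      exact ⟨S, hS, by simpa [ind] using h⟩)
  have hne : T.val ≠ W.val := by
    intro h
    have : T = W := Subtype.ext h
    subst this
    exact @lt_irrefl _ r.toPreorder _ hW1
  exact @lt_asymm _ r.toPreorder _ _ hW1 (hr W T (lt_of_le_of_ne hW hne))

/-- The toric parametrization. -/
noncomputable def toricMap {V : Type*} [Fintype V] [DecidableEq V] (G : SimpleGraph V) :
    MvPolynomial (Tube G) ℚ →ₐ[ℚ] MvPolynomial (V ⊕ Sym2 V) ℚ :=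
  MvPolynomial.aeval (fun T => MvPolynomial.monomial (Finsupp.equivFunOnFinite.symm (ind T.val)) 1)

theorem toricMap_monomial {V : Type*} [Fintype V] [DecidableEq V] (G : SimpleGraph V)
    (u : Tube G →₀ ℕ) (c : ℚ) : toricMap G (MvPolynomial.monomial u c) =
      MvPolynomial.monomial (Finsupp.equivFunOnFinite.symm (weightVec G u)) c := by
  have h : Finsupp.equivFunOnFinite.symm (weightVec G u) =
      u.sum (fun T n => n • Finsupp.equivFunOnFinite.symm (ind T.val)) := by
    ext x
    simp [weightVec_eq_sum, Finsupp.sum, Finsupp.finsetSum_apply]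
  rw [h, toricMap, MvPolynomial.aeval_monomial]
  simp only [MvPolynomial.monomial_pow, one_pow]
  rw [Finsupp.prod, ← MvPolynomial.monomial_sum_one, MvPolynomial.algebraMap_eq,
    MvPolynomial.C_mul_monomial, mul_one]
  rfl

theorem toricMap_eq_zero {V : Type*} [Fintype V] [DecidableEq V] (G : SimpleGraph V)
    (p : MvPolynomial (Tube G) ℚ) (hp : p ∈ toricIdeal G) : toricMap G p = 0 := by
  have : toricIdeal G ≤ RingHom.ker (toricMap G) := by
    refine Ideal.span_le.2 ?_
    rintro _ ⟨u, v, h, rfl⟩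
    simp [RingHom.mem_ker, toricMap_monomial, h]
  exact this hp

theorem exists_other {V : Type*} [Fintype V] [DecidableEq V] (G : SimpleGraph V)
    (p : MvPolynomial (Tube G) ℚ) (hp : p ∈ toricIdeal G) (m : Tube G →₀ ℕ)
    (hm : m ∈ p.support) : ∃ m' ∈ p.support, m' ≠ m ∧ weightVec G m = weightVec G m' := by
  classical
  by_contra hcon
  push Not at hcon
  have h := toricMap_eq_zero G p hp
  rw [p.as_sum, map_sum] at h
  have h2 := congrArg
    (MvPolynomial.coeff (Finsupp.equivFunOnFinite.symm (weightVec G m))) h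
  simp only [toricMap_monomial, MvPolynomial.coeff_sum, MvPolynomial.coeff_monomial,
    MvPolynomial.coeff_zero] at h2
  rw [Finset.sum_eq_single m] at h2
  · rw [if_pos rfl] at h2
    exact MvPolynomial.mem_support_iff.1 hm h2
  · intro b hb hne
    rw [if_neg]
    intro he
    exact hcon b hb hne (Finsupp.equivFunOnFinite.symm.injective he).symm
  · exact fun h => absurd hm h

theorem groebnerSet_subset {V : Type*} [Fintype V] [DecidableEq V] (G : SimpleGraph V) :
    groebnerSet G ⊆ (toricIdeal G : Set (MvPolynomial (Tube G) ℚ)) := by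
  classical
  rintro p ⟨S, T, W, hov, hW, 𝒰, h𝒰, rfl⟩
  refine Ideal.subset_span ⟨_, _, ?_, rfl⟩
  rw [weightVec_add, weightVec_add, weightVec_single, weightVec_single, weightVec_single,
    weightVec_finset_sum, ind_components _ _ h𝒰, hW, ind_sup_inf]

theorem exists_groebner {V : Type*} [Fintype V] [DecidableEq V]
    (G : SimpleGraph V) (r : LinearOrder (Tube G))
    (hr : ∀ T T' : Tube G, T'.val < T.val → r.lt T T') (S T : Tube G)
    (h : Overlapping S.val T.val) : ∃ p ∈ groebnerSet G,
      IsLeadMonomial r p (Finsupp.single S 1 + Finsupp.single T 1) := by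
  classical
  obtain ⟨v, hvS, hvT⟩ := h.1
  obtain ⟨𝒰, h𝒰⟩ := exists_components (S.val ⊓ T.val)
  let W : Tube G := ⟨S.val ⊔ T.val, connected_sup S.2 T.2 hvS hvT⟩
  have hSW : S.val < W.val := lt_of_le_of_ne le_sup_left fun e => h.2 (Or.inr (by
    rw [e]; exact le_sup_right))
  have hTW : T.val < W.val := lt_of_le_of_ne le_sup_right fun e => h.2 (Or.inl (by
    rw [e]; exact le_sup_left))
  have hle : ∀ U ∈ 𝒰, U.val < W.val := fun U hU =>
    lt_of_le_of_lt ((h𝒰.1 _ (Finset.mem_image_of_mem _ hU)).2.trans inf_le_left) hSW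
  have zero1 : ∀ R : Tube G, ¬ r.lt W R → (Finsupp.single S 1 + Finsupp.single T 1 : Tube G →₀ ℕ) R = 0 := by
    intro R hR
    have h1 : S ≠ R := fun e => hR (e ▸ hr _ _ hSW)
    have h2 : T ≠ R := fun e => hR (e ▸ hr _ _ hTW)
    simp [Finsupp.single_apply, h1, h2]
  have irr : ¬ r.lt W W := @lt_irrefl _ r.toPreorder _
  have hgt : RevLexGT r (Finsupp.single S 1 + Finsupp.single T 1)
      (Finsupp.single W 1 + ∑ U ∈ 𝒰, Finsupp.single U 1) := by
    refine ⟨W, ?_, ?_⟩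
    · rw [zero1 W irr]
      simp
    · intro R hR
      have hn : ¬ r.lt W R := @lt_asymm _ r.toPreorder _ _ hR
      rw [zero1 R hn, Finsupp.add_apply, Finsupp.finsetSum_apply, Finset.sum_eq_zero,
        Finsupp.single_apply, if_neg]
      · rfl
      · intro e; exact irr (e ▸ hR)
      · intro U hU
        rw [Finsupp.single_apply, if_neg]
        intro e; subst e
        exact hn (hr _ _ (hle _ hU))
  have hne : Finsupp.single S 1 + Finsupp.single T 1 ≠
      Finsupp.single W 1 + ∑ U ∈ 𝒰, Finsupp.single U 1 := by
    intro e
    obtain ⟨R, hR, _⟩ := hgt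
    rw [e] at hR
    exact lt_irrefl _ hR
  refine ⟨_, ⟨S, T, W, h, rfl, 𝒰, h𝒰, rfl⟩, ?_, ?_⟩
  · rw [MvPolynomial.mem_support_iff, MvPolynomial.coeff_sub, MvPolynomial.coeff_monomial,
      MvPolynomial.coeff_monomial, if_pos rfl, if_neg hne.symm]
    norm_num
  · intro m' hm' hm'ne
    rw [MvPolynomial.mem_support_iff, MvPolynomial.coeff_sub, MvPolynomial.coeff_monomial,
      MvPolynomial.coeff_monomial, if_neg hm'ne.symm] at hm'
    by_cases e : Finsupp.single W 1 + ∑ U ∈ 𝒰, Finsupp.single U 1 = m'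
    · rw [← e]; exact hgt
    · rw [if_neg e] at hm'; simp at hm'

theorem not_overlapping_self {V : Type*} {G : SimpleGraph V} (S : G.Subgraph) :
    ¬ Overlapping S S := fun h => h.2 (Or.inl le_rfl)

/-- `𝒢` is a Gröbner basis of the toric ideal `I_G` with respect to the
reverse lexicographic order induced by any total order on the variables with
`t_T < t_{T'}` whenever `T ⊋ T'`; consequently
`init(I_G) = (t_S t_T : S, T overlapping tubes)`. -/
theorem groebner_basis_toricIdeal {V : Type*} [Fintype V] [DecidableEq V]
    (G : SimpleGraph V) (r : LinearOrder (Tube G))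
    (hr : ∀ T T' : Tube G, T'.val < T.val → r.lt T T') :
    groebnerSet G ⊆ (toricIdeal G : Set (MvPolynomial (Tube G) ℚ)) ∧
    Ideal.span {q | ∃ p ∈ groebnerSet G, ∃ m, IsLeadMonomial r p m ∧
        q = MvPolynomial.monomial m (1 : ℚ)} = initIdeal G r ∧
    initIdeal G r = Ideal.span {q | ∃ S T : Tube G, Overlapping S.val T.val ∧
        q = MvPolynomial.X S * MvPolynomial.X T} :=
  by
  classical
  have hXX : ∀ S T : Tube G, (MvPolynomial.X S * MvPolynomial.X T : MvPolynomial (Tube G) ℚ) =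
      MvPolynomial.monomial (Finsupp.single S 1 + Finsupp.single T 1) 1 := by
    intro S T
    simp [MvPolynomial.X, MvPolynomial.monomial_mul]
  have h1 : Ideal.span {q | ∃ p ∈ groebnerSet G, ∃ m, IsLeadMonomial r p m ∧
        q = MvPolynomial.monomial m (1 : ℚ)} ≤ initIdeal G r := by
    refine Ideal.span_mono ?_
    rintro q ⟨p, hp, m, hm, rfl⟩
    exact ⟨p, groebnerSet_subset G hp, m, hm, rfl⟩
  have h2 : initIdeal G r ≤ Ideal.span {q | ∃ S T : Tube G, Overlapping S.val T.val ∧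
        q = MvPolynomial.X S * MvPolynomial.X T} := by
    refine Ideal.span_le.2 ?_
    rintro q ⟨p, hp, m, hm, rfl⟩
    by_cases hno : ∀ A B : Tube G, m A ≠ 0 → m B ≠ 0 → ¬ Overlapping A.val B.val
    · obtain ⟨m', hm', hne, hw⟩ := exists_other G p hp m hm.1
      exact absurd (hm.2 m' hm' hne) (not_revLexGT G r hr m m' hw hno)
    · push Not at hno
      obtain ⟨A, B, hA, hB, hAB⟩ := hno
      have hne : A ≠ B := by
        rintro rfl
        exact not_overlapping_self _ hAB
      have hle : Finsupp.single A 1 + Finsupp.single B 1 ≤ m := by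
        intro R
        rw [Finsupp.add_apply, Finsupp.single_apply, Finsupp.single_apply]
        by_cases ha : A = R
        · have hb : B ≠ R := fun e => hne (ha.trans e.symm)
          subst ha
          rw [if_pos rfl, if_neg hb]
          omega
        · rw [if_neg ha]
          split_ifs with hb
          · subst hb; omega
          · omega
      have hdiv : (MvPolynomial.monomial m (1 : ℚ)) =
          MvPolynomial.monomial (m - (Finsupp.single A 1 + Finsupp.single B 1)) 1 *
            (MvPolynomial.X A * MvPolynomial.X B) := by
        rw [hXX, MvPolynomial.monomial_mul, tsub_add_cancel_of_le hle, one_mul]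
      rw [hdiv]
      exact Ideal.mul_mem_left _ _ (Ideal.subset_span ⟨A, B, hAB, rfl⟩)
  have h3 : Ideal.span {q | ∃ S T : Tube G, Overlapping S.val T.val ∧
        q = MvPolynomial.X S * MvPolynomial.X T} ≤
      Ideal.span {q | ∃ p ∈ groebnerSet G, ∃ m, IsLeadMonomial r p m ∧
        q = MvPolynomial.monomial m (1 : ℚ)} := by
    refine Ideal.span_mono ?_
    rintro q ⟨S, T, h, rfl⟩
    obtain ⟨p, hp, hl⟩ := exists_groebner G r hr S T h
    exact ⟨p, hp, _, hl, hXX S T⟩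
  exact ⟨groebnerSet_subset G, le_antisymm h1 (h2.trans h3), le_antisymm h2 (h3.trans h1)⟩

end Cosmo
end
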